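/- Let n and k be integers with k ≥ 1 and 2k < n + 2. Set C(k,n) = Γ(n/2+1−k)/(2^{2k−1}·(k−1)!·Γ(n/2+1)) and, for 0 < r ≤ s, φ_k(r,s) = C(k,n)·s^{2k−2−n}·∑_{j=0}^{k−1} (−1)^j·binom(k−1,j)·((n/2+1−k)_j/(n/2+1)_j)·(r/s)^{2j}. Then there exists a constant C > 0 such that for all 0 < r ≤ s: (n+2−2k)·φ_k(r,s) + r·(d/dt φ_k(t,s))|_{t=r} ≥ C·s^{2k−2−n}, where the derivative is taken in the first argument. -/

import Mathlib

/-- The rising factorial (Pochhammer symbol) `(x)_j = x(x+1)⋯(x+j-1)`. -/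
noncomputable def risingFactorial (j : ℕ) (x : ℝ) : ℝ := (ascPochhammer ℝ j).eval x

/-- The constant `C(k,n) = Γ(n/2+1-k)/(2^{2k-1} (k-1)! Γ(n/2+1))`. -/
noncomputable def Ckn (k n : ℕ) : ℝ :=
  Real.Gamma ((n : ℝ) / 2 + 1 - k)
    / (2 ^ (2 * k - 1) * (Nat.factorial (k - 1) : ℝ) * Real.Gamma ((n : ℝ) / 2 + 1))

/-- The kernel factor
`φ_k(r,s) = C(k,n) s^{2k-2-n} ∑_{j=0}^{k-1} (-1)^j binom(k-1,j) ((n/2+1-k)_j/(n/2+1)_j) (r/s)^{2j}`,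
the finite sum being the terminating hypergeometric series `F(1-k, n/2+1-k; n/2+1; r²/s²)`. -/
noncomputable def phiK (k n : ℕ) (r s : ℝ) : ℝ :=
  Ckn k n * s ^ (2 * (k : ℤ) - 2 - (n : ℤ))
    * ∑ j ∈ Finset.range k,
        (-1 : ℝ) ^ j * (Nat.choose (k - 1) j : ℝ)
          * (risingFactorial j ((n : ℝ) / 2 + 1 - k) / risingFactorial j ((n : ℝ) / 2 + 1))
          * (r / s) ^ (2 * j)

theorem risingFactorial_zero (x : ℝ) : risingFactorial 0 x = 1 := by
  simp [risingFactorial]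

theorem risingFactorial_succ_right (j : ℕ) (x : ℝ) :
    risingFactorial (j + 1) x = risingFactorial j x * (x + j) := by
  simp [risingFactorial, ascPochhammer_succ_eval]

theorem risingFactorial_succ_left (j : ℕ) (x : ℝ) :
    risingFactorial (j + 1) x = x * risingFactorial j (x + 1) := by
  simp [risingFactorial, ascPochhammer_succ_left, Polynomial.eval_comp]

theorem risingFactorial_pos (j : ℕ) {x : ℝ} (hx : 0 < x) : 0 < risingFactorial j x :=
  ascPochhammer_pos j x hx

theorem risingFactorial_nonneg (j : ℕ) {x : ℝ} (hx : 0 ≤ x) : 0 ≤ risingFactorial j x := by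
  induction j with
  | zero => simp [risingFactorial_zero]
  | succ j ih =>
    rw [risingFactorial_succ_right]
    positivity

/-- The alternating binomial sum `∑ j ≤ m, (-1)^j binom(m,j) f(j) x^j`. -/
noncomputable def altBinomSum (m : ℕ) (f : ℕ → ℝ) (x : ℝ) : ℝ :=
  ∑ j ∈ Finset.range (m + 1), (-1 : ℝ) ^ j * (m.choose j : ℝ) * f j * x ^ j

theorem altBinomSum_succ (m : ℕ) (f : ℕ → ℝ) (x : ℝ) :
    altBinomSum (m + 1) f x
      = altBinomSum m f x - x * altBinomSum m (fun j => f (j + 1)) x := by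
  have h : altBinomSum m f x
      = ∑ j ∈ Finset.range (m + 1 + 1), (-1 : ℝ) ^ j * (m.choose j : ℝ) * f j * x ^ j := by
    rw [Finset.sum_range_succ _ (m + 1)]
    simp [altBinomSum]
  rw [h, altBinomSum, altBinomSum, Finset.sum_range_succ', Finset.sum_range_succ' _ (m + 1),
    Finset.mul_sum, add_sub_right_comm, ← Finset.sum_sub_distrib]
  congr 1
  · refine Finset.sum_congr rfl fun j _ => ?_
    rw [Nat.choose_succ_succ]
    push_cast
    ring
  · simp

theorem altBinomSum_sub (m : ℕ) (f g : ℕ → ℝ) (x : ℝ) :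
    altBinomSum m (fun j => f j - g j) x = altBinomSum m f x - altBinomSum m g x := by
  simp only [altBinomSum, ← Finset.sum_sub_distrib]
  exact Finset.sum_congr rfl fun j _ => by ring

theorem altBinomSum_const_mul (m : ℕ) (a : ℝ) (f : ℕ → ℝ) (x : ℝ) :
    altBinomSum m (fun j => a * f j) x = a * altBinomSum m f x := by
  simp only [altBinomSum, Finset.mul_sum]
  exact Finset.sum_congr rfl fun j _ => by ring

/-- The terminating hypergeometric polynomial `F(-m, b; c; x)`. -/
noncomputable def hypergeometricPoly (m : ℕ) (b c x : ℝ) : ℝ :=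
  altBinomSum m (fun j => risingFactorial j b / risingFactorial j c) x

theorem hypergeometricPoly_succ (m : ℕ) (b x : ℝ) {c : ℝ} (hc : 0 < c) :
    hypergeometricPoly (m + 1) b c x
      = (c - b) / c * hypergeometricPoly m b (c + 1) x
        + (1 - x) * (b / c * hypergeometricPoly m (b + 1) (c + 1) x) := by
  have h₁ : ∀ j : ℕ, b / c * (risingFactorial j (b + 1) / risingFactorial j (c + 1))
      = risingFactorial (j + 1) b / risingFactorial (j + 1) c := fun j => by
    rw [risingFactorial_succ_left, risingFactorial_succ_left, div_mul_div_comm]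
  have h₂ : ∀ j : ℕ, (c - b) / c * (risingFactorial j b / risingFactorial j (c + 1))
      = risingFactorial j b / risingFactorial j c
        - risingFactorial (j + 1) b / risingFactorial (j + 1) c := fun j => by
    have hj := (risingFactorial_pos j hc).ne'
    have hcj : c + j ≠ 0 := by positivity
    rw [div_mul_div_comm, ← risingFactorial_succ_left, risingFactorial_succ_right,
      risingFactorial_succ_right]
    field_simp
    ring
  rw [hypergeometricPoly, hypergeometricPoly, hypergeometricPoly,
    ← altBinomSum_const_mul m ((c - b) / c), ← altBinomSum_const_mul m (b / c)]
  simp only [h₁, h₂]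
  rw [altBinomSum_sub, altBinomSum_succ]
  ring

theorem le_hypergeometricPoly (m : ℕ) {b c x : ℝ} (hb : 0 < b) (hbc : b ≤ c) (hx : x ≤ 1) :
    risingFactorial m (c - b) / risingFactorial m c ≤ hypergeometricPoly m b c x := by
  induction m generalizing b c with
  | zero => simp [hypergeometricPoly, altBinomSum, risingFactorial_zero]
  | succ m ih =>
    have hc : 0 < c := hb.trans_le hbc
    have h₁ := ih hb (hbc.trans (le_add_of_nonneg_right zero_le_one))
    have h₂ := ih (add_pos hb one_pos) (add_le_add_left hbc 1)
    have h₃ : 0 ≤ risingFactorial m (c + 1 - (b + 1)) / risingFactorial m (c + 1) := by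
      refine div_nonneg ?_ (risingFactorial_pos m (by positivity)).le
      exact risingFactorial_nonneg m (by linarith)
    rw [hypergeometricPoly_succ m b x hc, risingFactorial_succ_left, risingFactorial_succ_left,
      ← div_mul_div_comm, show c - b + 1 = c + 1 - b by ring]
    exact le_add_of_le_of_nonneg
      (mul_le_mul_of_nonneg_left h₁ (div_nonneg (sub_nonneg.2 hbc) hc.le))
      (mul_nonneg (sub_nonneg.2 hx) (mul_nonneg (by positivity) (h₃.trans h₂)))

theorem mul_deriv_phiK (k n : ℕ) (r s : ℝ) :
    r * deriv (fun t => phiK k n t s) r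
      = Ckn k n * s ^ (2 * (k : ℤ) - 2 - (n : ℤ))
        * ∑ j ∈ Finset.range k, (2 * j : ℝ) *
            ((-1 : ℝ) ^ j * (Nat.choose (k - 1) j : ℝ)
              * (risingFactorial j ((n : ℝ) / 2 + 1 - k) / risingFactorial j ((n : ℝ) / 2 + 1))
              * (r / s) ^ (2 * j)) := by
  have h : HasDerivAt (fun t => phiK k n t s) _ r :=
    (HasDerivAt.fun_sum fun j _ =>
      (((hasDerivAt_id' r).div_const s).fun_pow (2 * j)).const_mul
        ((-1 : ℝ) ^ j * (Nat.choose (k - 1) j : ℝ)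
          * (risingFactorial j ((n : ℝ) / 2 + 1 - k)
            / risingFactorial j ((n : ℝ) / 2 + 1)))).const_mul
        (Ckn k n * s ^ (2 * (k : ℤ) - 2 - (n : ℤ)))
  rw [h.deriv, mul_left_comm, Finset.mul_sum]
  congr 1
  refine Finset.sum_congr rfl fun j _ => ?_
  rcases j with _ | j
  · simp
  · rw [show 2 * (j + 1) - 1 = 2 * j + 1 by lia, show 2 * (j + 1) = 2 * j + 1 + 1 by lia,
      pow_succ (r / s) (2 * j + 1)]
    push_cast
    ring

theorem phiK_add_deriv_eq_hypergeometricPoly (n k : ℕ) (hk : 1 ≤ k) (r s : ℝ) :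
    ((n : ℝ) + 2 - 2 * k) * phiK k n r s + r * deriv (fun t => phiK k n t s) r
      = Ckn k n * ((n : ℝ) + 2 - 2 * k)
          * hypergeometricPoly (k - 1) ((n : ℝ) / 2 + 1 - k + 1) ((n : ℝ) / 2 + 1) ((r / s) ^ 2)
        * s ^ (2 * (k : ℤ) - 2 - (n : ℤ)) := by
  have h : ∀ j : ℕ, ((n : ℝ) / 2 + 1 - k + j) * risingFactorial j ((n : ℝ) / 2 + 1 - k)
      = ((n : ℝ) / 2 + 1 - k) * risingFactorial j ((n : ℝ) / 2 + 1 - k + 1) := fun j => by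
    rw [← risingFactorial_succ_left, risingFactorial_succ_right, mul_comm]
  rw [mul_deriv_phiK, phiK, hypergeometricPoly, altBinomSum, Nat.sub_add_cancel hk]
  simp only [Finset.mul_sum, Finset.sum_mul, ← Finset.sum_add_distrib]
  refine Finset.sum_congr rfl fun j _ => ?_
  rw [← pow_mul]
  linear_combination 2 * Ckn k n * s ^ (2 * (k : ℤ) - 2 - (n : ℤ)) * (-1 : ℝ) ^ j
    * (Nat.choose (k - 1) j : ℝ) / risingFactorial j ((n : ℝ) / 2 + 1) * (r / s) ^ (2 * j) * h j

/-- Second kernel condition for the comparison-based breakdown criterion: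
for `1 ≤ k` and `2k < n + 2`, there is a constant `C > 0` such that for all `0 < r ≤ s`,
`(n+2-2k) φ_k(r,s) + r ∂₁φ_k(r,s) ≥ C s^{2k-2-n}`, the derivative being in the first
argument. -/
theorem kernel_condition_two
    (n k : ℕ) (hk : 1 ≤ k) (hkn : 2 * k < n + 2) :
    ∃ C : ℝ, 0 < C ∧ ∀ r s : ℝ, 0 < r → r ≤ s →
      C * s ^ (2 * (k : ℤ) - 2 - (n : ℤ))
        ≤ ((n : ℝ) + 2 - 2 * k) * phiK k n r s
          + r * deriv (fun t => phiK k n t s) r := by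
  have hkn' : (2 * k : ℝ) < n + 2 := by exact_mod_cast hkn
  have ha : 0 < (n : ℝ) / 2 + 1 - k := by linarith
  have hk' : (1 : ℝ) ≤ k := by exact_mod_cast hk
  have hc : 0 < (n : ℝ) / 2 + 1 := by positivity
  have hC : 0 < Ckn k n * ((n : ℝ) + 2 - 2 * k) := by
    have := Real.Gamma_pos_of_pos ha
    have := Real.Gamma_pos_of_pos hc
    exact mul_pos (by unfold Ckn; positivity) (by linarith)
  have hm : 0 < risingFactorial (k - 1) ((n : ℝ) / 2 + 1 - ((n : ℝ) / 2 + 1 - k + 1)) := by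
    rw [show (n : ℝ) / 2 + 1 - ((n : ℝ) / 2 + 1 - k + 1) = k - 1 by ring]
    rcases hk.eq_or_lt with rfl | h
    · simp [risingFactorial_zero]
    · exact risingFactorial_pos _ (sub_pos.2 (by exact_mod_cast h))
  refine ⟨_, mul_pos hC (div_pos hm (risingFactorial_pos (k - 1) hc)), fun r s hr hrs => ?_⟩
  have hs : 0 < s := hr.trans_le hrs
  rw [phiK_add_deriv_eq_hypergeometricPoly n k hk]
  refine mul_le_mul_of_nonneg_right (mul_le_mul_of_nonneg_left ?_ hC.le) (zpow_pos hs _).le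
  exact le_hypergeometricPoly _ (by linarith) (by linarith)
    (pow_le_one₀ (by positivity) ((div_le_one hs).2 hrs))
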